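/- arXiv:1203.1584 — 2 statements merged into one kernel-verified Lean document; each statement's English description precedes it below -/
import Mathlib

section
/- If G is a connected graph of order n which contains a cycle, then β(G) ≤ n - g(G) + 2, where g(G) is the girth of G (the length of a shortest cycle). -/
open SimpleGraph

/-- `W` is a resolving set for `G`: distinct vertices have distinct distance vectors to `W`. -/
def Resolves {V : Type*} (G : SimpleGraph V) (W : Set V) : Prop :=
  ∀ u v : V, u ≠ v → ∃ w ∈ W, G.dist u w ≠ G.dist v w

/-- The metric dimension of `G`: minimum cardinality of a resolving set. -/
noncomputable def metricDim {V : Type*} [Fintype V] (G : SimpleGraph V) : ℕ :=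
  sInf {k | ∃ W : Finset V, W.card = k ∧ Resolves G ↑W}

lemma dist_on_cycle {V : Type*} (G : SimpleGraph V) (hG : G.Connected) {a : V}
    (c : G.Walk a a) (hc : c.IsCycle) (hg : G.girth = c.length) (i j : ℕ) (hij : i ≤ j)
    (hj : j < c.length) :
    G.dist (c.getVert i) (c.getVert j) = min (j - i) (c.length - (j - i)) := by
  obtain ⟨q, hq, hql⟩ : ∃ q : G.Walk (c.getVert i) (c.getVert j), q.IsPath ∧ q.length = j - i := by
    have e : (c.take j).getVert i = c.getVert i := by
      rw [Walk.take_getVert, min_eq_right hij]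
    refine ⟨((c.take j).drop i).copy e rfl, ?_, ?_⟩
    · rw [Walk.isPath_copy]
      exact (hc.isPath_take hj).drop i
    · rw [Walk.length_copy, Walk.drop_length, Walk.take_length, min_eq_left hj.le]
  have h1 : G.dist (c.getVert i) (c.getVert j) ≤ j - i := hql ▸ dist_le q
  have h2 : G.dist (c.getVert i) (c.getVert j) ≤ c.length - (j - i) := by
    have := dist_le ((c.drop j).append (c.take i)).reverse
    simp only [Walk.length_reverse, Walk.length_append, Walk.drop_length, Walk.take_length] at this
    omega
  obtain ⟨p, hp, hpl⟩ := hG.exists_path_of_dist (c.getVert i) (c.getVert j)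
  by_contra hne
  have hpq : p ≠ q := by
    rintro rfl
    omega
  obtain ⟨w, -, -, hw⟩ := hp.exists_isCycle_length_le_add_of_ne hq hpq
  obtain ⟨d, hd, hdl⟩ := hw
  have := girth_le_length hd
  omega

theorem stmt2 {V : Type*} [Fintype V] (G : SimpleGraph V) (hG : G.Connected)
    (hc : ¬ G.IsAcyclic) :
    metricDim G ≤ Fintype.card V - G.girth + 2 := by
  classical
  obtain ⟨a, c, hcy, hg⟩ := exists_girth_eq_length.mpr hc
  have h3 := three_le_girth hc
  have hinj : Set.InjOn c.getVert (Finset.Ico 2 G.girth : Finset ℕ) := by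
    intro x hx y hy h
    simp only [Finset.coe_Ico, Set.mem_Ico] at hx hy
    exact hcy.getVert_injOn' (show x ≤ c.length - 1 by omega) (show y ≤ c.length - 1 by omega) h
  have key : ∀ w : V, w ∉ (Finset.univ \ (Finset.Ico 2 G.girth).image c.getVert) →
      ∃ i, 2 ≤ i ∧ i < G.girth ∧ c.getVert i = w := by
    intro w hw
    simpa [and_assoc] using hw
  have h01 : ∀ k, k < 2 →
      c.getVert k ∈ (Finset.univ \ (Finset.Ico 2 G.girth).image c.getVert) := by
    intro k hk
    simp only [Finset.mem_sdiff, Finset.mem_univ, true_and, Finset.mem_image, Finset.mem_Ico,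
      not_exists, not_and, and_imp]
    intro x hx hx' h
    have := hcy.getVert_injOn' (show x ≤ c.length - 1 by omega)
      (show k ≤ c.length - 1 by omega) h
    omega
  have hres : Resolves G ↑(Finset.univ \ (Finset.Ico 2 G.girth).image c.getVert) := by
    intro u v huv
    by_cases hu : u ∈ (Finset.univ \ (Finset.Ico 2 G.girth).image c.getVert)
    · refine ⟨u, hu, ?_⟩
      rw [dist_self]
      exact (hG.pos_dist_of_ne huv.symm).ne
    by_cases hv : v ∈ (Finset.univ \ (Finset.Ico 2 G.girth).image c.getVert)
    · refine ⟨v, hv, ?_⟩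
      rw [dist_self]
      exact (hG.pos_dist_of_ne huv).ne'
    obtain ⟨i, hi, hi', rfl⟩ := key u hu
    obtain ⟨j, hj, hj', rfl⟩ := key v hv
    by_contra! H
    have H0 := H _ (h01 0 (by omega))
    have H1 := H _ (h01 1 (by omega))
    rw [dist_comm, dist_comm (u := c.getVert j),
      dist_on_cycle G hG c hcy hg _ _ (by omega) (by omega),
      dist_on_cycle G hG c hcy hg _ _ (by omega) (by omega)] at H0 H1
    have : i = j := by omega
    exact huv (by rw [this])
  have hle : metricDim G ≤ _ := Nat.sInf_le ⟨_, rfl, hres⟩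
  refine hle.trans ?_
  rw [Finset.card_sdiff_of_subset (Finset.subset_univ _), Finset.card_image_of_injOn hinj,
    Nat.card_Ico, Finset.card_univ]
  omega
end

section
/- Let G be a connected graph of order n containing a cycle. Then β(G) = n - g(G) + 2 if and only if G is a cycle C_n, a complete graph K_n with n ≥ 3, or a complete bipartite graph K_{r,s} with r,s ≥ 2. -/
open SimpleGraph

theorem metricDim_le_of_sep {V : Type*} [Fintype V] (G : SimpleGraph V) (hG : G.Connected)
    (S : Finset V)
    (h : ∀ a ∈ S, ∀ b ∈ S, a ≠ b → ∃ w, w ∉ S ∧ G.dist a w ≠ G.dist b w) :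
    metricDim G ≤ Fintype.card V - S.card := by
  classical
  refine Nat.sInf_le ⟨Sᶜ, Finset.card_compl S, ?_⟩
  intro u v huv
  by_cases hu : u ∈ S
  · by_cases hv : v ∈ S
    · obtain ⟨w, hw, hd⟩ := h u hu v hv huv
      exact ⟨w, by simpa using hw, hd⟩
    · refine ⟨v, by simpa using hv, ?_⟩
      have := hG.pos_dist_of_ne huv
      simp only [dist_self]; omega
  · refine ⟨u, by simpa using hu, ?_⟩
    have := hG.pos_dist_of_ne huv.symm
    simp only [dist_self]; omega

theorem metricDim_le_of_fun {V : Type*} [Fintype V] (G : SimpleGraph V) (hG : G.Connected)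
    (T : Finset ℕ) (f : ℕ → V)
    (h : ∀ i ∈ T, ∀ j ∈ T, i < j →
      ∃ w, (∀ k ∈ T, f k ≠ w) ∧ G.dist (f i) w ≠ G.dist (f j) w) :
    metricDim G ≤ Fintype.card V - T.card := by
  classical
  have hinj : Set.InjOn f T := by
    intro i hi j hj hij
    rcases lt_trichotomy i j with hlt | heq | hlt
    · obtain ⟨w, -, hw⟩ := h i hi j hj hlt
      exact absurd (by rw [hij]) hw
    · exact heq
    · obtain ⟨w, -, hw⟩ := h j hj i hi hlt
      exact absurd (by rw [hij]) hw
  rw [← Finset.card_image_of_injOn hinj]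
  apply metricDim_le_of_sep G hG
  intro a ha b hb hab
  obtain ⟨i, hi, rfl⟩ := Finset.mem_image.1 ha
  obtain ⟨j, hj, rfl⟩ := Finset.mem_image.1 hb
  have key : ∀ w, (∀ k ∈ T, f k ≠ w) → w ∉ T.image f := by
    intro w hw hm
    obtain ⟨k, hk, hk'⟩ := Finset.mem_image.1 hm
    exact hw k hk hk'
  rcases lt_trichotomy i j with hlt | heq | hlt
  · obtain ⟨w, h1, h2⟩ := h i hi j hj hlt
    exact ⟨w, key w h1, h2⟩
  · exact absurd (by rw [heq]) hab
  · obtain ⟨w, h1, h2⟩ := h j hj i hi hlt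
    exact ⟨w, key w h1, h2.symm⟩

theorem le_metricDim_of {V : Type*} [Fintype V] (G : SimpleGraph V) (hG : G.Connected) (k : ℕ)
    (h : ∀ W : Finset V, Resolves G ↑W → k ≤ W.card) : k ≤ metricDim G := by
  have hne : {k | ∃ W : Finset V, W.card = k ∧ Resolves G ↑W}.Nonempty := by
    refine ⟨_, Finset.univ, rfl, ?_⟩
    intro u v huv
    refine ⟨u, by simp, ?_⟩
    have := hG.pos_dist_of_ne huv.symm
    simp only [dist_self]; omega
  obtain ⟨W, hW, hR⟩ := Nat.sInf_mem hne
  have := h W hR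
  unfold metricDim
  omega

theorem girth_le_path_dist {V : Type*} {G : SimpleGraph V} (hG : G.Connected) {u v : V}
    (p : G.Walk u v) (hp : p.IsPath) (hne : G.dist u v ≠ p.length) :
    G.girth ≤ p.length + G.dist u v := by
  obtain ⟨q, hq, hl⟩ := hG.exists_path_of_dist u v
  have hpq : p ≠ q := by
    rintro rfl
    exact hne hl.symm
  have := hp.exists_isCycle_length_le_add_of_ne hq hpq
  obtain ⟨x, hx⟩ := this
  grind [girth_le_length]

theorem cycle_dist {V : Type*} {G : SimpleGraph V} (hG : G.Connected) {u : V}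
    (w : G.Walk u u) (hw : w.IsCycle) (hl : G.girth = w.length) (i j : ℕ)
    (hi : i < G.girth) (hj : j < G.girth) :
    G.dist (w.getVert i) (w.getVert j) =
      min ((i - j) + (j - i)) (G.girth - ((i - j) + (j - i))) := by
  wlog hij : i ≤ j generalizing i j
  · rw [dist_comm, this j i hj hi (by omega)]
    congr 1 <;> omega
  have up1 : ∀ i j, i ≤ j → j ≤ w.length → G.dist (w.getVert i) (w.getVert j) ≤ j - i := by
    intro i j hij hj
    have h1 := dist_le ((w.take j).drop i)
    simp only [Walk.take_getVert, Walk.drop_length, Walk.take_length] at h1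
    rw [min_eq_right hij] at h1
    omega
  have h1 := up1 i j hij (by omega)
  have h2 := up1 0 i (by omega) (by omega)
  have h3 := up1 j w.length (by omega) (by omega)
  rw [Walk.getVert_length] at h3
  rw [Walk.getVert_zero] at h2
  have h4 := hG.dist_triangle (u := w.getVert j) (v := u) (w := w.getVert i)
  rw [dist_comm] at h4
  have hp : ((w.take j).drop i).IsPath := (hw.isPath_take (by omega)).drop i
  have h5 := girth_le_path_dist hG _ hp
  simp only [Walk.take_getVert, Walk.drop_length, Walk.take_length] at h5
  rw [min_eq_right hij] at h5
  omega

theorem attach_dist {V : Type*} {G : SimpleGraph V} (hG : G.Connected) {u v : V}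
    (w : G.Walk u u) (hw : w.IsCycle) (hl : G.girth = w.length) (hv : v ∉ w.support)
    (huv : G.Adj v u) (i : ℕ) (hi : i < G.girth) :
    G.dist v (w.getVert i) ≤ i + 1 ∧
    (G.dist v (w.getVert i) = i + 1 ∨ G.girth ≤ i + 1 + G.dist v (w.getVert i)) ∧
    G.dist v (w.getVert i) ≤ G.girth - i + 1 ∧
    (0 < i → G.dist v (w.getVert i) = G.girth - i + 1 ∨ i ≤ 1 + G.dist v (w.getVert i)) := by
  have a1 := dist_le (Walk.cons huv (w.take i))
  have a2 := dist_le (Walk.cons huv (w.drop i).reverse)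
  simp only [Walk.length_cons, Walk.take_length, Walk.length_reverse, Walk.drop_length] at a1 a2
  have p1 : (Walk.cons huv (w.take i)).IsPath := by
    rw [Walk.cons_isPath_iff]
    exact ⟨hw.isPath_take (by omega), fun h => hv ((Walk.isSubwalk_take w i).support_subset h)⟩
  have b1 := girth_le_path_dist hG _ p1
  simp only [Walk.length_cons, Walk.take_length] at b1
  refine ⟨by omega, by omega, by omega, ?_⟩
  intro hi0
  have p2 : (Walk.cons huv (w.drop i).reverse).IsPath := by
    rw [Walk.cons_isPath_iff]
    refine ⟨(hw.isPath_drop hi0).reverse, fun h => hv ?_⟩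
    rw [Walk.support_reverse, List.mem_reverse] at h
    exact ((Walk.isSubwalk_drop w i).support_subset h)
  have b2 := girth_le_path_dist hG _ p2
  simp only [Walk.length_cons, Walk.length_reverse, Walk.drop_length] at b2
  omega

theorem girth_le_card {V : Type*} [Fintype V] {G : SimpleGraph V} {u : V}
    (w : G.Walk u u) (hw : w.IsCycle) (hl : G.girth = w.length) :
    G.girth ≤ Fintype.card V := by
  have := hw.support_nodup.length_le_card
  simp at this
  omega

theorem metricDim_le_girth {V : Type*} [Fintype V] {G : SimpleGraph V} (hG : G.Connected)
    (hc : ¬ G.IsAcyclic) : metricDim G ≤ Fintype.card V - G.girth + 2 := by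
  obtain ⟨u, w, hw, hl⟩ := exists_girth_eq_length.2 hc
  have h3 := three_le_girth hc
  have hn := girth_le_card w hw hl
  have hd := cycle_dist hG w hw hl
  have := metricDim_le_of_fun G hG (((Finset.range G.girth).erase 0).erase 1) w.getVert (by
    intro i hi j hj hij
    simp only [Finset.mem_erase, Finset.mem_range] at hi hj
    have hne : ∀ m, m = 0 ∨ m = 1 → ∀ k ∈ ((Finset.range G.girth).erase 0).erase 1,
        w.getVert k ≠ w.getVert m := by
      intro m hm k hk he
      simp only [Finset.mem_erase, Finset.mem_range] at hk
      have := hd k m (by omega) (by omega)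
      rw [he, dist_self] at this
      omega
    by_contra! hcon
    have e0 := hcon _ (hne 0 (by simp))
    have e1 := hcon _ (hne 1 (by simp))
    rw [hd _ _ (by omega) (by omega), hd _ _ (by omega) (by omega)] at e0 e1
    omega)
  rw [Finset.card_erase_of_mem (by simp; omega), Finset.card_erase_of_mem (by simp; omega),
    Finset.card_range] at this
  omega

/-- either the cycle covers everything or it can be rotated so that an outside vertex is attached at its base -/
theorem cover_or_attach {V : Type*} {G : SimpleGraph V} (hG : G.Connected)
    (hc : ¬ G.IsAcyclic) :
    ∃ (u : V) (w : G.Walk u u), w.IsCycle ∧ G.girth = w.length ∧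
      ((∀ x, x ∈ w.support) ∨ ∃ v, v ∉ w.support ∧ G.Adj v u) := by
  classical
  obtain ⟨u, w, hw, hl⟩ := exists_girth_eq_length.2 hc
  by_cases h : ∀ x, x ∈ w.support
  · exact ⟨u, w, hw, hl, Or.inl h⟩
  push Not at h
  obtain ⟨x, hx⟩ := h
  obtain ⟨p⟩ := hG.preconnected u x
  obtain ⟨d, -, h1, h2⟩ := p.exists_boundary_dart {y | y ∈ w.support} (by simp) hx
  refine ⟨d.fst, w.rotate d.fst h1, by simpa using hw, by simpa using hl, Or.inr ⟨d.snd, ?_, d.adj.symm⟩⟩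
  simpa using h2

theorem metricDim_lt_attach {V : Type*} [Fintype V] {G : SimpleGraph V} (hG : G.Connected)
    (h5 : 5 ≤ G.girth) {u v : V} (w : G.Walk u u) (hw : w.IsCycle) (hl : G.girth = w.length)
    (hv : v ∉ w.support) (huv : G.Adj v u) :
    metricDim G < Fintype.card V - G.girth + 2 := by
  have hn := girth_le_card w hw hl
  have hd := cycle_dist hG w hw hl
  have hat := attach_dist hG w hw hl hv huv
  have hvne : ∀ k, w.getVert k ≠ v := by
    rintro k rfl
    exact hv (Walk.getVert_mem_support _ _)
  by_cases h6 : G.girth = 6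
  · have := metricDim_le_of_fun G hG ((Finset.range G.girth).erase 1) w.getVert (by
      intro i hi j hj hij
      simp only [Finset.mem_erase, Finset.mem_range] at hi hj
      have hne : ∀ k ∈ (Finset.range G.girth).erase 1, w.getVert k ≠ w.getVert 1 := by
        intro k hk he
        simp only [Finset.mem_erase, Finset.mem_range] at hk
        have := hd k 1 (by omega) (by omega)
        rw [he, dist_self] at this
        omega
      by_cases h35 : i = 3 ∧ j = 5
      · obtain ⟨rfl, rfl⟩ := h35
        by_cases h2 : G.dist v (w.getVert 3) = 2
        · obtain ⟨p, hp⟩ := hG.exists_walk_length_eq_dist v (w.getVert 3)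
          have a1 : G.Adj v (p.getVert 1) := by
            simpa using p.adj_getVert_succ (i := 0) (by omega)
          have a2 : G.Adj (p.getVert 1) (w.getVert 3) := by
            have := p.adj_getVert_succ (i := 1) (by omega)
            rwa [p.getVert_of_length_le (i := 1 + 1) (by omega)] at this
          have a3 : ∀ k, k < 6 → w.getVert k ≠ p.getVert 1 := by
            intro k hk he
            rw [← he, ← dist_eq_one_iff_adj] at a1 a2
            rw [hd _ _ (by omega) (by omega)] at a2
            have := hat k (by omega)
            omega
          refine ⟨p.getVert 1, ?_, ?_⟩
          · intro k hk
            simp only [Finset.mem_erase, Finset.mem_range] at hk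
            exact a3 k (by omega)
          · rw [dist_comm, dist_eq_one_iff_adj.2 a2]
            intro he
            have b3 : G.Adj (w.getVert 3) (w.getVert 4) := w.adj_getVert_succ (by omega)
            have b4 : G.Adj (w.getVert 4) (w.getVert 5) := w.adj_getVert_succ (by omega)
            have hp : (Walk.cons a2 (Walk.cons b3 (Walk.cons b4 Walk.nil))).IsPath := by
              have n1 := a3 3 (by omega)
              have n2 := a3 4 (by omega)
              have n3 := a3 5 (by omega)
              have n4 : w.getVert 3 ≠ w.getVert 5 := by
                intro he
                have := hd 3 5 (by omega) (by omega)
                rw [he, dist_self] at this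
                omega
              simp [Walk.cons_isPath_iff, n1.symm, n2.symm, n3.symm, n4, b3.ne, b4.ne]
            have := girth_le_path_dist hG _ hp
            rw [dist_comm (u := p.getVert 1)] at this
            simp only [Walk.length_cons, Walk.length_nil] at this
            omega
        · refine ⟨v, fun k _ => hvne k, ?_⟩
          rw [dist_comm, dist_comm (u := w.getVert 5)]
          have := hat 5 (by omega)
          omega
      · by_contra! hcon
        have e0 := hcon _ hne
        have e1 := hcon v (fun k _ => hvne k)
        rw [dist_comm, dist_comm (v := v)] at e1
        rw [hd _ _ (by omega) (by omega), hd _ _ (by omega) (by omega)] at e0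
        have := hat i (by omega)
        have := hat j (by omega)
        omega)
    rw [Finset.card_erase_of_mem (by simp; omega), Finset.card_range] at this
    omega
  · have := metricDim_le_of_fun G hG (((Finset.range (G.girth + 1)).erase 1).erase (G.girth - 1))
      (fun k => if k = G.girth then v else w.getVert k) (by
      intro i hi j hj hij
      simp only [Finset.mem_erase, Finset.mem_range] at hi hj
      have hne : ∀ m, m = 1 ∨ m = G.girth - 1 →
          ∀ k ∈ ((Finset.range (G.girth + 1)).erase 1).erase (G.girth - 1),
          (if k = G.girth then v else w.getVert k) ≠ w.getVert m := by
        intro m hm k hk he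
        simp only [Finset.mem_erase, Finset.mem_range] at hk
        split_ifs at he with hkg
        · exact hvne m he.symm
        have := hd k m (by omega) (by omega)
        rw [he, dist_self] at this
        omega
      by_contra! hcon
      have e0 := hcon _ (hne 1 (by simp))
      have e1 := hcon _ (hne (G.girth - 1) (by simp))
      rw [if_neg (by omega)] at e0 e1
      by_cases hjg : j = G.girth
      · rw [if_pos hjg, hd _ _ (by omega) (by omega)] at e0 e1
        have := hat 1 (by omega)
        have := hat (G.girth - 1) (by omega)
        omega
      · rw [if_neg hjg, hd _ _ (by omega) (by omega), hd _ _ (by omega) (by omega)] at e0 e1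
        omega)
    rw [Finset.card_erase_of_mem (by simp; omega), Finset.card_erase_of_mem (by simp; omega),
      Finset.card_range] at this
    omega

theorem iso_cycle_of_cover {V : Type*} [Fintype V] {G : SimpleGraph V} (hG : G.Connected)
    {u : V} (w : G.Walk u u) (hw : w.IsCycle) (hl : G.girth = w.length)
    (hcov : ∀ x, x ∈ w.support) : Nonempty (G ≃g cycleGraph (Fintype.card V)) := by
  have hd := cycle_dist hG w hw hl
  have h3 := hw.three_le_length
  have hbij : Function.Bijective (fun i : Fin G.girth => w.getVert i) := by
    constructor
    · intro i j hij
      have := hd i j i.2 j.2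
      simp only at hij
      rw [hij, dist_self] at this
      ext
      have := i.2
      have := j.2
      omega
    · intro x
      obtain ⟨n, hn, hle⟩ := Walk.mem_support_iff_exists_getVert.1 (hcov x)
      by_cases h : n = G.girth
      · refine ⟨⟨0, by omega⟩, ?_⟩
        simp only [Walk.getVert_zero]
        rw [← hn, h, hl, Walk.getVert_length]
      · exact ⟨⟨n, by omega⟩, hn⟩
  have hcard : Fintype.card V = G.girth := by
    rw [← Fintype.card_of_bijective hbij, Fintype.card_fin]
  rw [hcard]
  refine ⟨RelIso.symm ⟨Equiv.ofBijective _ hbij, ?_⟩⟩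
  intro i j
  simp only [Equiv.ofBijective_apply]
  rw [← dist_eq_one_iff_adj, hd i j i.2 j.2, cycleGraph_adj']
  have := i.2
  have := j.2
  rcases lt_trichotomy i j with h | h | h
  · rw [Fin.coe_sub_iff_lt.2 h, Fin.coe_sub_iff_le.2 h.le]
    rw [Fin.lt_def] at h
    omega
  · subst h
    rw [Fin.coe_sub_iff_le.2 le_rfl]
    omega
  · rw [Fin.coe_sub_iff_lt.2 h, Fin.coe_sub_iff_le.2 h.le]
    rw [Fin.lt_def] at h
    omega

theorem twin_dist_le {V : Type*} {G : SimpleGraph V} (hG : G.Connected) {u v : V}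
    (h : ∀ x, G.Adj u x → G.Adj v x) {w : V} (hu : w ≠ u) : G.dist v w ≤ G.dist u w := by
  obtain ⟨p, hp⟩ := hG.exists_walk_length_eq_dist u w
  cases p with
  | nil => exact absurd rfl hu
  | cons ha q =>
    have := dist_le (Walk.cons (h _ ha) q)
    simp only [Walk.length_cons] at this hp
    omega

theorem case_top {V : Type*} [Fintype V] {G : SimpleGraph V} (hG : G.Connected)
    (hc : ¬ G.IsAcyclic) (h : G = ⊤) :
    metricDim G = Fintype.card V - G.girth + 2 := by
  classical
  have h3 := three_le_girth hc
  obtain ⟨u, w, hw, hl⟩ := exists_girth_eq_length.2 hc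
  have hn := girth_le_card w hw hl
  have hle := metricDim_le_girth hG hc
  have : Fintype.card V - 1 ≤ metricDim G := by
    apply le_metricDim_of G hG
    intro W hW
    have h1 : Wᶜ.card ≤ 1 := by
      rw [Finset.card_le_one]
      intro a ha b hb
      by_contra hab
      obtain ⟨x, hx, hd⟩ := hW a b hab
      simp only [Finset.mem_compl] at ha hb
      apply hd
      have hax : a ≠ x := fun e => ha (e ▸ hx)
      have hbx : b ≠ x := fun e => hb (e ▸ hx)
      rw [h, dist_top_of_ne hax, dist_top_of_ne hbx]
    have := Finset.card_compl_add_card W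
    omega
  omega

theorem case_bip {V : Type*} [Fintype V] {G : SimpleGraph V} (hG : G.Connected)
    (hc : ¬ G.IsAcyclic) (s : V → Bool) (h : ∀ x y, G.Adj x y ↔ s x ≠ s y) :
    metricDim G = Fintype.card V - G.girth + 2 := by
  classical
  have h3 := three_le_girth hc
  obtain ⟨u, w, hw, hl⟩ := exists_girth_eq_length.2 hc
  have hn := girth_le_card w hw hl
  have hle := metricDim_le_girth hG hc
  have h4 : G.girth ≠ 3 := by
    intro h3
    have a1 := w.adj_getVert_succ (i := 0) (by omega)
    have a2 := w.adj_getVert_succ (i := 1) (by omega)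
    have a3 := w.adj_getVert_succ (i := 2) (by omega)
    rw [w.getVert_of_length_le (i := 2 + 1) (by omega)] at a3
    rw [w.getVert_zero] at a1
    rw [h] at a1 a2 a3
    simp only [zero_add, Nat.reduceAdd] at a1 a2 a3
    revert a1 a2 a3
    cases s u <;> cases s (w.getVert 1) <;> cases s (w.getVert 2) <;> simp
  have : Fintype.card V - 2 ≤ metricDim G := by
    apply le_metricDim_of G hG
    intro W hW
    have h1 : Wᶜ.card ≤ 2 := by
      have := Finset.card_le_card_of_injOn (s := Wᶜ) (t := Finset.univ) s
        (fun _ _ => Finset.mem_coe.2 (Finset.mem_univ _)) (by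
        intro a ha b hb hab
        by_contra hne
        obtain ⟨x, hx, hd⟩ := hW a b hne
        simp only [Finset.coe_compl, Set.mem_compl_iff] at ha hb
        apply hd
        have hax : x ≠ a := fun e => ha (e ▸ hx)
        have hbx : x ≠ b := fun e => hb (e ▸ hx)
        apply le_antisymm
        · exact twin_dist_le hG (fun y hy => by rw [h] at hy ⊢; rwa [hab]) hbx
        · exact twin_dist_le hG (fun y hy => by rw [h] at hy ⊢; rwa [← hab]) hax)
      simpa using this
    have := Finset.card_compl_add_card W
    omega
  omega

theorem case_cycle {V : Type*} [Fintype V] {G : SimpleGraph V} (hG : G.Connected)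
    (hc : ¬ G.IsAcyclic) (e : G ≃g cycleGraph (Fintype.card V)) :
    metricDim G = Fintype.card V - G.girth + 2 := by
  classical
  have h3 := three_le_girth hc
  obtain ⟨u, w, hw, hl, hor⟩ := cover_or_attach hG hc
  have hn := girth_le_card w hw hl
  have hle := metricDim_le_girth hG hc
  have hdeg : ∀ x, G.degree x = 2 := by
    intro x
    rw [← e.degree_eq]
    generalize e x = y
    clear e
    revert y
    obtain ⟨m, hm⟩ : ∃ m, Fintype.card V = m + 3 := ⟨Fintype.card V - 3, by omega⟩
    rw [hm]
    intro y
    convert cycleGraph_degree_three_le (v := y)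
  have hgn : Fintype.card V ≤ G.girth := by
    rcases hor with hcov | ⟨v, hv, huv⟩
    · have hsub : (Finset.univ : Finset V) ⊆ (Finset.range G.girth).image w.getVert := by
        intro x _
        obtain ⟨n, hn, hle⟩ := Walk.mem_support_iff_exists_getVert.1 (hcov x)
        rw [Finset.mem_image]
        by_cases h : n = G.girth
        · refine ⟨0, by simp; omega, ?_⟩
          rw [Walk.getVert_zero, ← hn, h, hl, Walk.getVert_length]
        · exact ⟨n, by simp; omega, hn⟩
      have h1 := Finset.card_le_card hsub
      have h2 := Finset.card_image_le (s := Finset.range G.girth) (f := w.getVert)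
      rw [Finset.card_range] at h2
      rw [Finset.card_univ] at h1
      omega
    · exfalso
      have hsub : ({v, w.snd, w.penultimate} : Finset V) ⊆ G.neighborFinset u := by
        intro x hx
        simp only [Finset.mem_insert, Finset.mem_singleton] at hx
        rw [mem_neighborFinset]
        rcases hx with rfl | rfl | rfl
        · exact huv.symm
        · exact w.adj_snd hw.not_nil
        · exact (w.adj_penultimate hw.not_nil).symm
      have h1 := Finset.card_le_card hsub
      rw [card_neighborFinset_eq_degree, hdeg, Finset.card_eq_three.2] at h1
      · omega
      · refine ⟨_, _, _, ?_, ?_, hw.snd_ne_penultimate, rfl⟩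
        · rintro rfl; exact hv (w.getVert_mem_support _)
        · rintro rfl; exact hv (w.getVert_mem_support _)
  have : 2 ≤ metricDim G := by
    apply le_metricDim_of G hG
    intro W hW
    by_contra hlt
    have hW1 : W.card ≤ 1 := by omega
    obtain ⟨x, hx⟩ : ∃ x, W ⊆ {x} := by
      rcases W.eq_empty_or_nonempty with rfl | ⟨x, hx⟩
      · exact ⟨u, by simp⟩
      · exact ⟨x, fun y hy => by
          rw [Finset.mem_singleton]; exact Finset.card_le_one.1 hW1 y hy x hx⟩
    have hd2 := hdeg x
    rw [← card_neighborFinset_eq_degree, Finset.card_eq_two] at hd2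
    obtain ⟨a, b, hab, hN⟩ := hd2
    obtain ⟨y, hy, hd⟩ := hW a b hab
    have hyx : y = x := by simpa using hx hy
    subst hyx
    have ha : G.Adj y a := by rw [← mem_neighborFinset, hN]; simp
    have hb : G.Adj y b := by rw [← mem_neighborFinset, hN]; simp
    rw [dist_eq_one_iff_adj.2 ha.symm, dist_eq_one_iff_adj.2 hb.symm] at hd
    exact hd rfl
  omega

theorem girth_three {V : Type*} [Fintype V] {G : SimpleGraph V} (hG : G.Connected)
    (h : G ≠ ⊤) : metricDim G ≤ Fintype.card V - 2 := by
  classical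
  have : ∃ x y, x ≠ y ∧ ¬ G.Adj x y := by
    by_contra! hcon
    apply h
    ext x y
    exact ⟨fun h => h.ne, fun h => hcon x y h⟩
  obtain ⟨x, y, hxy, hna⟩ := this
  obtain ⟨p, hp⟩ := hG.exists_walk_length_eq_dist x y
  obtain ⟨a, b, c, hab, hbc, hac, hne⟩ :=
    Walk.exists_adj_adj_not_adj_ne hp (hG.one_lt_dist_of_ne_of_not_adj hxy hna)
  have := metricDim_le_of_sep G hG {b, c} (by
    intro s hs t ht hst
    refine ⟨a, by simp [hab.ne, hne], ?_⟩
    simp only [Finset.mem_insert, Finset.mem_singleton] at hs ht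
    have e1 := dist_eq_one_iff_adj.2 hab.symm
    have e2 : G.dist c a ≠ 1 := by
      rw [Ne, dist_eq_one_iff_adj]
      exact fun h => hac h.symm
    rcases hs with rfl | rfl <;> rcases ht with rfl | rfl
    · exact absurd rfl hst
    · rw [e1]; exact e2.symm
    · rw [e1]; exact e2
    · exact absurd rfl hst)
  rwa [Finset.card_pair hbc.ne] at this

theorem exists_vert_dist_eq {V : Type*} {G : SimpleGraph V} (hG : G.Connected) (x y : V) (k : ℕ)
    (hk : k ≤ G.dist x y) : ∃ z, G.dist x z = k := by
  obtain ⟨p, hp⟩ := hG.exists_walk_length_eq_dist x y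
  refine ⟨p.getVert k, ?_⟩
  have := length_eq_dist_of_subwalk hp (p.isSubwalk_take k)
  rw [Walk.take_length] at this
  omega

theorem three_sep {V : Type*} [Fintype V] {G : SimpleGraph V} (hG : G.Connected) (a b c : V)
    (h1 : ∃ w, w ≠ a ∧ w ≠ b ∧ w ≠ c ∧ G.dist a w ≠ G.dist b w)
    (h2 : ∃ w, w ≠ a ∧ w ≠ b ∧ w ≠ c ∧ G.dist a w ≠ G.dist c w)
    (h3 : ∃ w, w ≠ a ∧ w ≠ b ∧ w ≠ c ∧ G.dist b w ≠ G.dist c w) :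
    metricDim G ≤ Fintype.card V - 3 := by
  have := metricDim_le_of_fun G hG (Finset.range 3)
    (fun k => if k = 0 then a else if k = 1 then b else c) (by
    intro i hi j hj hij
    rw [Finset.mem_range] at hi hj
    have key : ∀ w, w ≠ a ∧ w ≠ b ∧ w ≠ c → ∀ k ∈ Finset.range 3,
        (if k = 0 then a else if k = 1 then b else c) ≠ w := by
      intro w hw k _
      split_ifs
      · exact hw.1.symm
      · exact hw.2.1.symm
      · exact hw.2.2.symm
    have hcases : (i = 0 ∧ j = 1) ∨ (i = 0 ∧ j = 2) ∨ (i = 1 ∧ j = 2) := by omega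
    rcases hcases with ⟨rfl, rfl⟩ | ⟨rfl, rfl⟩ | ⟨rfl, rfl⟩
    · obtain ⟨w, e1, e2, e3, hw⟩ := h1
      exact ⟨w, key w ⟨e1, e2, e3⟩, by simpa using hw⟩
    · obtain ⟨w, e1, e2, e3, hw⟩ := h2
      exact ⟨w, key w ⟨e1, e2, e3⟩, by simpa using hw⟩
    · obtain ⟨w, e1, e2, e3, hw⟩ := h3
      exact ⟨w, key w ⟨e1, e2, e3⟩, by simpa using hw⟩)
  rwa [Finset.card_range] at this

theorem no_triangle {V : Type*} {G : SimpleGraph V} (hG : G.Connected) (h4 : 4 ≤ G.girth)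
    {a b c : V} (hab : G.Adj a b) (hbc : G.Adj b c) : ¬ G.Adj a c := by
  intro hac
  have hp : (Walk.cons hab (Walk.cons hbc Walk.nil)).IsPath := by
    simp [Walk.cons_isPath_iff, hab.ne, hbc.ne, hac.ne]
  have := girth_le_path_dist hG _ hp
  rw [dist_eq_one_iff_adj.2 hac] at this
  simp only [Walk.length_cons, Walk.length_nil] at this
  omega

theorem girth_four {V : Type*} [Fintype V] {G : SimpleGraph V} (hG : G.Connected)
    (hc : ¬ G.IsAcyclic) (h4 : G.girth = 4)
    (hlt : ¬ metricDim G ≤ Fintype.card V - 3) :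
    ∃ r s : ℕ, 2 ≤ r ∧ 2 ≤ s ∧
        Nonempty (G ≃g completeBipartiteGraph (Fin r) (Fin s)) := by
  classical
  have hdiam : ∀ x y, G.dist x y ≤ 2 := by
    intro x y
    by_contra hxy
    obtain ⟨a, ha⟩ := exists_vert_dist_eq hG x y 1 (by omega)
    obtain ⟨b, hb⟩ := exists_vert_dist_eq hG x y 2 (by omega)
    obtain ⟨c, hc⟩ := exists_vert_dist_eq hG x y 3 (by omega)
    have na : x ≠ a := by rintro rfl; simp at ha
    have nb : x ≠ b := by rintro rfl; simp at hb
    have nc : x ≠ c := by rintro rfl; simp at hc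
    rw [dist_comm] at ha hb hc
    exact hlt (three_sep hG a b c ⟨x, na, nb, nc, by omega⟩ ⟨x, na, nb, nc, by omega⟩
      ⟨x, na, nb, nc, by omega⟩)
  have hcommon : ∀ x y, x ≠ y → ¬ G.Adj x y → ∃ w, G.Adj x w ∧ G.Adj w y := by
    intro x y hxy hna
    have h1 := hG.one_lt_dist_of_ne_of_not_adj hxy hna
    have h2 := hdiam x y
    obtain ⟨p, hp⟩ := hG.exists_walk_length_eq_dist x y
    refine ⟨p.getVert 1, ?_, ?_⟩
    · simpa using p.adj_getVert_succ (i := 0) (by omega)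
    · have := p.adj_getVert_succ (i := 1) (by omega)
      rwa [p.getVert_of_length_le (i := 1 + 1) (by omega)] at this
  have htrans : ∀ x y z, ¬ G.Adj x y → ¬ G.Adj y z → ¬ G.Adj x z := by
    intro x y z hxy hyz hxz
    have n1 : x ≠ y := by rintro rfl; exact hyz hxz
    have n2 : y ≠ z := by rintro rfl; exact hxy hxz
    obtain ⟨w, hxw, hwy⟩ := hcommon x y n1 hxy
    obtain ⟨u, hyu, huz⟩ := hcommon y z n2 hyz
    have hxu : ¬ G.Adj x u := no_triangle hG h4.ge hxz huz.symm
    have hzw : ¬ G.Adj z w := no_triangle hG h4.ge hxz.symm hxw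
    have nux : x ≠ u := by rintro rfl; exact hxy hyu.symm
    have nzw : z ≠ w := by rintro rfl; exact hyz hwy.symm
    have adj1 : ∀ {a b : V}, G.Adj a b → G.dist b a = 1 := fun h => dist_eq_one_iff_adj.2 h.symm
    have nadj : ∀ {a b : V}, ¬ G.Adj a b → G.dist b a ≠ 1 :=
      fun h h' => h (dist_eq_one_iff_adj.1 h').symm
    refine hlt (three_sep hG w u y ⟨x, hxw.ne, nux, n1, ?_⟩ ⟨x, hxw.ne, nux, n1, ?_⟩
      ⟨z, nzw, huz.symm.ne, n2.symm, ?_⟩)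
    · rw [adj1 hxw]; exact (nadj hxu).symm
    · rw [adj1 hxw]; exact (nadj hxy).symm
    · rw [adj1 huz.symm]; exact (nadj (fun h => hyz h.symm)).symm
  obtain ⟨u, w, hw, hl⟩ := exists_girth_eq_length.2 hc
  have hd := cycle_dist hG w hw hl
  have hadj : ∀ x y, G.Adj x y ↔ ¬ (G.Adj u x ↔ G.Adj u y) := by
    intro x y
    constructor
    · intro hxy hiff
      by_cases hx : G.Adj u x
      · exact no_triangle hG h4.ge hx hxy (hiff.1 hx)
      · have hy := fun h => hx (hiff.2 h)
        exact htrans x u y (fun h => hx h.symm) hy hxy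
    · intro hiff
      by_contra hxy
      apply hiff
      constructor
      · intro hx
        by_contra hy
        exact htrans u y x hy (fun h => hxy h.symm) hx
      · intro hy
        by_contra hx
        exact htrans u x y hx hxy hy
  have hc : ∀ i, i < 4 → (G.Adj u (w.getVert i) ↔ (i = 1 ∨ i = 3)) := by
    intro i hi
    have := hd 0 i (by omega) (by omega)
    rw [Walk.getVert_zero] at this
    rw [← dist_eq_one_iff_adj, this]
    omega
  have hne : ∀ i j, i < j → j < 4 → w.getVert i ≠ w.getVert j := by
    intro i j hij hj he
    have := hd i j (by omega) (by omega)
    rw [he, SimpleGraph.dist_self] at this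
    omega
  refine ⟨Fintype.card {x // G.Adj u x}, Fintype.card {x // ¬ G.Adj u x}, ?_, ?_, ⟨?_⟩⟩
  · apply Fintype.one_lt_card_iff.2
    exact ⟨⟨w.getVert 1, (hc 1 (by omega)).2 (by omega)⟩,
      ⟨w.getVert 3, (hc 3 (by omega)).2 (by omega)⟩,
      fun h => hne 1 3 (by omega) (by omega) (Subtype.ext_iff.1 h)⟩
  · apply Fintype.one_lt_card_iff.2
    exact ⟨⟨w.getVert 0, fun h => absurd ((hc 0 (by omega)).1 h) (by omega)⟩,
      ⟨w.getVert 2, fun h => absurd ((hc 2 (by omega)).1 h) (by omega)⟩,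
      fun h => hne 0 2 (by omega) (by omega) (Subtype.ext_iff.1 h)⟩
  · let e : ({x // G.Adj u x} ⊕ {x // ¬ G.Adj u x}) ≃ V := Equiv.sumCompl _
    let f := Equiv.sumCongr (Fintype.equivFin {x // G.Adj u x}) (Fintype.equivFin {x // ¬ G.Adj u x})
    refine RelIso.symm ⟨f.symm.trans e, ?_⟩
    intro a b
    rw [hadj]
    rcases a with a | a <;> rcases b with b | b
    · have ha := ((Fintype.equivFin {x // G.Adj u x}).symm a).2
      have hb := ((Fintype.equivFin {x // G.Adj u x}).symm b).2
      simp [f, e, ha, hb]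
    · have ha := ((Fintype.equivFin {x // G.Adj u x}).symm a).2
      have hb := ((Fintype.equivFin {x // ¬ G.Adj u x}).symm b).2
      simp [f, e, ha, hb]
    · have ha := ((Fintype.equivFin {x // ¬ G.Adj u x}).symm a).2
      have hb := ((Fintype.equivFin {x // G.Adj u x}).symm b).2
      simp [f, e, ha, hb]
    · have ha := ((Fintype.equivFin {x // ¬ G.Adj u x}).symm a).2
      have hb := ((Fintype.equivFin {x // ¬ G.Adj u x}).symm b).2
      simp [f, e, ha, hb]

theorem stmt7 {V : Type*} [Fintype V] (G : SimpleGraph V) (hG : G.Connected)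
    (hc : ¬ G.IsAcyclic) :
    metricDim G = Fintype.card V - G.girth + 2 ↔
      Nonempty (G ≃g cycleGraph (Fintype.card V)) ∨
      (3 ≤ Fintype.card V ∧ G = ⊤) ∨
      (∃ r s : ℕ, 2 ≤ r ∧ 2 ≤ s ∧
        Nonempty (G ≃g completeBipartiteGraph (Fin r) (Fin s))) := by
  constructor
  · intro heq
    have h3 := three_le_girth hc
    obtain ⟨u, w, hw, hl, hor⟩ := cover_or_attach hG hc
    have hn := girth_le_card w hw hl
    by_cases e3 : G.girth = 3
    · right; left
      refine ⟨by omega, ?_⟩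
      by_contra hne
      have := girth_three hG hne
      omega
    by_cases e4 : G.girth = 4
    · right; right
      exact girth_four hG hc e4 (by omega)
    rcases hor with hcov | ⟨v, hv, huv⟩
    · exact Or.inl (iso_cycle_of_cover hG w hw hl hcov)
    · have := metricDim_lt_attach hG (by omega) w hw hl hv huv
      omega
  · rintro (⟨⟨e⟩⟩ | ⟨-, h⟩ | ⟨r, s, -, -, ⟨e⟩⟩)
    · exact case_cycle hG hc e
    · exact case_top hG hc h
    · refine case_bip hG hc (fun x => (e x).isLeft) ?_
      intro x y
      rw [← e.map_adj_iff]
      generalize e x = a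
      generalize e y = b
      rcases a with a | a <;> rcases b with b | b <;> simp
end
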